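/- Horizon length achieving a performance-loss specification: in the setting of the T-step receding-horizon performance bound, let ρ ∈ (0,1), δ̄ > 0, and ω̄, ω̲, λ̲, λ̄ > 0 be given constants with λ̲ ≤ ω̄, and let β̄ > 0 be a prescribed loss tolerance. If the integer horizon T ≥ 1 satisfies T ≥ 1 + log( (1/δ̄) · log( (β̄ · λ̲ · ω̲)/(ω̄ · λ̄ · ω̄) + 1 ) ) / log(ρ), then (λ̄/λ̲) · (ω̄/ω̲) · ω̄ · (exp(ρ^{T−1} · δ̄) − 1) ≤ β̄; consequently, under the hypotheses of the T-step performance bound, the infinite-horizon performance loss satisfies Σ_{t=0}^∞ (x_tᵀ Q_t x_t + u_tᵀ R_t u_t) − ξᵀ P_0 ξ ≤ β̄ · |ξ|² for every initial state ξ ∈ ℝⁿ. -/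

import Mathlib

open Matrix

/-- The spectral (operator) norm of a real square matrix, induced by the Euclidean norm. -/
noncomputable def specNorm {n : ℕ} (M : Matrix (Fin n) (Fin n) ℝ) : ℝ :=
  ‖Matrix.toEuclideanCLM (𝕜 := ℝ) M‖

/-- The smallest eigenvalue of a (symmetric) real square matrix. -/
noncomputable def lamMin {n : ℕ} (M : Matrix (Fin n) (Fin n) ℝ) : ℝ :=
  sInf (spectrum ℝ M)

/-- The Riemannian distance `δ(Y,Z) = sqrt (Σᵢ (log λᵢ)²)` where `λ₁, …, λₙ` are the
eigenvalues, with multiplicity, of `Y Z⁻¹` (equivalently, of `Z^{-1/2} Y Z^{-1/2}`),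
realized as the roots of its characteristic polynomial. -/
noncomputable def riemDelta {n : ℕ} (Y Z : Matrix (Fin n) (Fin n) ℝ) : ℝ :=
  Real.sqrt ((((Y * Z⁻¹).charpoly.roots).map (fun r => Real.log r ^ 2)).sum)

/-- The time-`t` Riccati operator
`𝓡_t(P) = Q_t + A_tᵀ (P − P B_t (R_t + B_tᵀ P B_t)⁻¹ B_tᵀ P) A_t`. -/
noncomputable def ricc {n m : ℕ} (A : Matrix (Fin n) (Fin n) ℝ) (B : Matrix (Fin n) (Fin m) ℝ)
    (Q : Matrix (Fin n) (Fin n) ℝ) (R : Matrix (Fin m) (Fin m) ℝ)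
    (P : Matrix (Fin n) (Fin n) ℝ) : Matrix (Fin n) (Fin n) ℝ :=
  Q + Aᵀ * (P - P * B * (R + Bᵀ * P * B)⁻¹ * (Bᵀ * P)) * A

/-- `riccIter A B Q R s k X = 𝓡_s ∘ 𝓡_{s+1} ∘ ⋯ ∘ 𝓡_{s+k−1} (X)`. -/
noncomputable def riccIter {n m : ℕ} (A : ℕ → Matrix (Fin n) (Fin n) ℝ)
    (B : ℕ → Matrix (Fin n) (Fin m) ℝ) (Q : ℕ → Matrix (Fin n) (Fin n) ℝ)
    (R : ℕ → Matrix (Fin m) (Fin m) ℝ) :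
    ℕ → ℕ → Matrix (Fin n) (Fin n) ℝ → Matrix (Fin n) (Fin n) ℝ
  | _, 0, X => X
  | s, k + 1, X => ricc (A s) (B s) (Q s) (R s) (riccIter A B Q R (s + 1) k X)

lemma aux_dot_tr {k l : ℕ} (M : Matrix (Fin k) (Fin l) ℝ) (v : Fin l → ℝ) (w : Fin k → ℝ) :
    v ⬝ᵥ Mᵀ *ᵥ w = (M *ᵥ v) ⬝ᵥ w := by
  rw [dotProduct_mulVec, vecMul_transpose]

lemma aux_symm {k : ℕ} {M : Matrix (Fin k) (Fin k) ℝ} (h : M.IsHermitian) : Mᵀ = M := by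
  have := h.eq
  rwa [conjTranspose_eq_transpose_of_trivial] at this

lemma aux_dot_symm {k : ℕ} {M : Matrix (Fin k) (Fin k) ℝ} (h : M.IsHermitian)
    (v w : Fin k → ℝ) : v ⬝ᵥ M *ᵥ w = w ⬝ᵥ M *ᵥ v := by
  conv_lhs => rw [← aux_symm h, aux_dot_tr, dotProduct_comm]

lemma aux_S_posDef {n m : ℕ} (B : Matrix (Fin n) (Fin m) ℝ) {R : Matrix (Fin m) (Fin m) ℝ}
    {P : Matrix (Fin n) (Fin n) ℝ} (hR : R.PosDef) (hP : P.PosDef) :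
    (R + Bᵀ * P * B).PosDef := by
  have := hP.posSemidef.conjTranspose_mul_mul_same B
  rw [conjTranspose_eq_transpose_of_trivial] at this
  exact hR.add_posSemidef this

lemma aux_square {n m : ℕ} (A : Matrix (Fin n) (Fin n) ℝ) (B : Matrix (Fin n) (Fin m) ℝ)
    (Q : Matrix (Fin n) (Fin n) ℝ) {R : Matrix (Fin m) (Fin m) ℝ}
    {P : Matrix (Fin n) (Fin n) ℝ} (hR : R.PosDef) (hP : P.PosDef)
    (x : Fin n → ℝ) (u : Fin m → ℝ) :
    x ⬝ᵥ Q *ᵥ x + u ⬝ᵥ R *ᵥ u + (A *ᵥ x + B *ᵥ u) ⬝ᵥ P *ᵥ (A *ᵥ x + B *ᵥ u)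
      = x ⬝ᵥ (ricc A B Q R P) *ᵥ x
        + (u + ((R + Bᵀ * P * B)⁻¹ * (Bᵀ * P * A)) *ᵥ x) ⬝ᵥ
          (R + Bᵀ * P * B) *ᵥ (u + ((R + Bᵀ * P * B)⁻¹ * (Bᵀ * P * A)) *ᵥ x) := by
  have hS := aux_S_posDef B hR hP
  unfold ricc
  set S := R + Bᵀ * P * B with hSdef
  set y := A *ᵥ x with hy
  set g := Bᵀ *ᵥ (P *ᵥ y) with hg
  set w := S⁻¹ *ᵥ g with hw
  have hSw : S *ᵥ w = g := by
    rw [hw, mulVec_mulVec, Matrix.mul_nonsing_inv _ ((isUnit_iff_isUnit_det S).1 hS.isUnit),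
      one_mulVec]
  have h1 : (S⁻¹ * (Bᵀ * P * A)) *ᵥ x = w := by
    simp only [hw, hg, hy, mulVec_mulVec, Matrix.mul_assoc]
  have h2 : (Q + Aᵀ * (P - P * B * S⁻¹ * (Bᵀ * P)) * A) *ᵥ x
      = Q *ᵥ x + Aᵀ *ᵥ (P *ᵥ y - P *ᵥ (B *ᵥ w)) := by
    simp only [hw, hg, hy, mulVec_mulVec, Matrix.mul_assoc, add_mulVec, sub_mulVec, mulVec_sub,
      Matrix.mul_sub, Matrix.sub_mul]
  have h3 : ∀ v : Fin m → ℝ, S *ᵥ v = R *ᵥ v + Bᵀ *ᵥ (P *ᵥ (B *ᵥ v)) := by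
    intro v
    simp only [hSdef, mulVec_mulVec, Matrix.mul_assoc, add_mulVec]
  have h4 : ∀ v : Fin m → ℝ, y ⬝ᵥ P *ᵥ (B *ᵥ v) = v ⬝ᵥ g := by
    intro v
    rw [hg, aux_dot_tr, aux_dot_symm hP.1]
  have h5 : (B *ᵥ u) ⬝ᵥ P *ᵥ y = u ⬝ᵥ g := by rw [hg, aux_dot_tr]
  have h6 : u ⬝ᵥ S *ᵥ u = u ⬝ᵥ R *ᵥ u + (B *ᵥ u) ⬝ᵥ P *ᵥ (B *ᵥ u) := by
    rw [h3, dotProduct_add, aux_dot_tr]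
  have h7 : w ⬝ᵥ S *ᵥ u = u ⬝ᵥ g := by rw [aux_dot_symm hS.1, hSw]
  rw [h1, h2, dotProduct_add, aux_dot_tr, ← hy, dotProduct_sub, h4]
  simp only [mulVec_add, dotProduct_add, add_dotProduct]
  rw [h4, h5, h6, h7, hSw]
  ring

lemma aux_ricc_herm {n m : ℕ} (A : Matrix (Fin n) (Fin n) ℝ) (B : Matrix (Fin n) (Fin m) ℝ)
    {Q : Matrix (Fin n) (Fin n) ℝ} {R : Matrix (Fin m) (Fin m) ℝ}
    {P : Matrix (Fin n) (Fin n) ℝ} (hQ : Q.PosDef) (hR : R.PosDef) (hP : P.PosDef) :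
    (ricc A B Q R P).IsHermitian := by
  have hS := aux_symm (aux_S_posDef B hR hP).1
  have hP' := aux_symm hP.1
  have hQ' := aux_symm hQ.1
  unfold ricc Matrix.IsHermitian
  rw [conjTranspose_eq_transpose_of_trivial]
  generalize R + Bᵀ * P * B = S at hS
  simp only [transpose_add, transpose_mul, transpose_sub, transpose_transpose, transpose_nonsing_inv,
    hS, hP', hQ', Matrix.mul_assoc]

lemma aux_ricc_le {n m : ℕ} (A : Matrix (Fin n) (Fin n) ℝ) (B : Matrix (Fin n) (Fin m) ℝ)
    (Q : Matrix (Fin n) (Fin n) ℝ) {R : Matrix (Fin m) (Fin m) ℝ}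
    {P : Matrix (Fin n) (Fin n) ℝ} (hR : R.PosDef) (hP : P.PosDef)
    (x : Fin n → ℝ) (u : Fin m → ℝ) :
    x ⬝ᵥ (ricc A B Q R P) *ᵥ x ≤
    x ⬝ᵥ Q *ᵥ x + u ⬝ᵥ R *ᵥ u + (A *ᵥ x + B *ᵥ u) ⬝ᵥ P *ᵥ (A *ᵥ x + B *ᵥ u) := by
  rw [aux_square A B Q hR hP]
  have := (aux_S_posDef B hR hP).posSemidef.dotProduct_mulVec_nonneg
    (u + ((R + Bᵀ * P * B)⁻¹ * (Bᵀ * P * A)) *ᵥ x)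
  rw [star_trivial] at this
  linarith

lemma aux_ricc_eq {n m : ℕ} (A : Matrix (Fin n) (Fin n) ℝ) (B : Matrix (Fin n) (Fin m) ℝ)
    (Q : Matrix (Fin n) (Fin n) ℝ) {R : Matrix (Fin m) (Fin m) ℝ}
    {P : Matrix (Fin n) (Fin n) ℝ} (hR : R.PosDef) (hP : P.PosDef)
    (x : Fin n → ℝ) (u : Fin m → ℝ)
    (hu : u = -(((R + Bᵀ * P * B)⁻¹ * (Bᵀ * P * A)) *ᵥ x)) :
    x ⬝ᵥ Q *ᵥ x + u ⬝ᵥ R *ᵥ u + (A *ᵥ x + B *ᵥ u) ⬝ᵥ P *ᵥ (A *ᵥ x + B *ᵥ u)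
      = x ⬝ᵥ (ricc A B Q R P) *ᵥ x := by
  rw [aux_square A B Q hR hP, hu, neg_add_cancel]
  simp

lemma aux_ricc_posDef {n m : ℕ} (A : Matrix (Fin n) (Fin n) ℝ) (B : Matrix (Fin n) (Fin m) ℝ)
    {Q : Matrix (Fin n) (Fin n) ℝ} {R : Matrix (Fin m) (Fin m) ℝ}
    {P : Matrix (Fin n) (Fin n) ℝ} (hQ : Q.PosDef) (hR : R.PosDef) (hP : P.PosDef) :
    (ricc A B Q R P).PosDef := by
  refine .of_dotProduct_mulVec_pos (aux_ricc_herm A B hQ hR hP) fun x hx => ?_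
  rw [star_trivial, ← aux_ricc_eq A B Q hR hP x _ rfl]
  have h1 := hQ.dotProduct_mulVec_pos hx
  have h2 := hR.posSemidef.dotProduct_mulVec_nonneg
    (-(((R + Bᵀ * P * B)⁻¹ * (Bᵀ * P * A)) *ᵥ x))
  have h3 := hP.posSemidef.dotProduct_mulVec_nonneg
    (A *ᵥ x + B *ᵥ (-(((R + Bᵀ * P * B)⁻¹ * (Bᵀ * P * A)) *ᵥ x)))
  rw [star_trivial] at h1 h2 h3
  linarith

lemma aux_ricc_mono {n m : ℕ} (A : Matrix (Fin n) (Fin n) ℝ) (B : Matrix (Fin n) (Fin m) ℝ)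
    {Q : Matrix (Fin n) (Fin n) ℝ} {R : Matrix (Fin m) (Fin m) ℝ}
    {P P' : Matrix (Fin n) (Fin n) ℝ} (hQ : Q.PosDef) (hR : R.PosDef) (hP : P.PosDef)
    (hP' : P'.PosDef) (h : (P' - P).PosSemidef) :
    (ricc A B Q R P' - ricc A B Q R P).PosSemidef := by
  refine .of_dotProduct_mulVec_nonneg
    ((aux_ricc_herm A B hQ hR hP').sub (aux_ricc_herm A B hQ hR hP)) fun x => ?_
  rw [star_trivial, sub_mulVec, dotProduct_sub, ← aux_ricc_eq A B Q hR hP' x _ rfl]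
  have h1 := aux_ricc_le A B Q hR hP x (-(((R + Bᵀ * P' * B)⁻¹ * (Bᵀ * P' * A)) *ᵥ x))
  have h2 := h.dotProduct_mulVec_nonneg
    (A *ᵥ x + B *ᵥ (-(((R + Bᵀ * P' * B)⁻¹ * (Bᵀ * P' * A)) *ᵥ x)))
  rw [star_trivial, sub_mulVec, dotProduct_sub] at h2
  linarith

section iter
variable {n m : ℕ} (A : ℕ → Matrix (Fin n) (Fin n) ℝ)
    (B : ℕ → Matrix (Fin n) (Fin m) ℝ) {Q : ℕ → Matrix (Fin n) (Fin n) ℝ}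
    {R : ℕ → Matrix (Fin m) (Fin m) ℝ}

lemma aux_iter_posDef (hQ : ∀ t, (Q t).PosDef) (hR : ∀ t, (R t).PosDef)
    (k : ℕ) : ∀ (s : ℕ) (X : Matrix (Fin n) (Fin n) ℝ), X.PosDef →
      (riccIter A B Q R s k X).PosDef := by
  induction k with
  | zero => intro s X hX; exact hX
  | succ k ih => intro s X hX; exact aux_ricc_posDef _ _ (hQ s) (hR s) (ih (s + 1) X hX)

lemma aux_iter_mono (hQ : ∀ t, (Q t).PosDef) (hR : ∀ t, (R t).PosDef)
    (k : ℕ) : ∀ (s : ℕ) (X Y : Matrix (Fin n) (Fin n) ℝ), X.PosDef → Y.PosDef →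
      (Y - X).PosSemidef →
      (riccIter A B Q R s k Y - riccIter A B Q R s k X).PosSemidef := by
  induction k with
  | zero => intro s X Y _ _ h; exact h
  | succ k ih =>
    intro s X Y hX hY h
    exact aux_ricc_mono _ _ (hQ s) (hR s) (aux_iter_posDef A B hQ hR k _ _ hX)
      (aux_iter_posDef A B hQ hR k _ _ hY) (ih (s + 1) X Y hX hY h)

lemma aux_iter_last (k : ℕ) : ∀ (s : ℕ) (X : Matrix (Fin n) (Fin n) ℝ),
    riccIter A B Q R s (k + 1) X =
      riccIter A B Q R s k (ricc (A (s + k)) (B (s + k)) (Q (s + k)) (R (s + k)) X) := by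
  induction k with
  | zero => intro s X; rfl
  | succ k ih =>
    intro s X
    change ricc _ _ _ _ (riccIter A B Q R (s + 1) (k + 1) X) = ricc _ _ _ _ _
    rw [ih (s + 1) X, show s + 1 + k = s + (k + 1) by ring]

lemma aux_iter_contr (hQ : ∀ t, (Q t).PosDef) (hR : ∀ t, (R t).PosDef)
    {ρ : ℝ} (hρ0 : 0 < ρ)
    (hcontr : ∀ t, ∀ Y Z : Matrix (Fin n) (Fin n) ℝ, Y.PosDef → Z.PosDef →
      riemDelta (ricc (A t) (B t) (Q t) (R t) Y) (ricc (A t) (B t) (Q t) (R t) Z)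
        ≤ ρ * riemDelta Y Z)
    {P : ℕ → Matrix (Fin n) (Fin n) ℝ} (hPpos : ∀ t, (P t).PosDef)
    (hPrec : ∀ t, P t = ricc (A t) (B t) (Q t) (R t) (P (t + 1)))
    (k : ℕ) : ∀ (s : ℕ) (X : Matrix (Fin n) (Fin n) ℝ), X.PosDef →
      riemDelta (riccIter A B Q R s k X) (P s) ≤ ρ ^ k * riemDelta X (P (s + k)) := by
  induction k with
  | zero => intro s X _; simp [riccIter]
  | succ k ih =>
    intro s X hX
    have h1 := hcontr s _ _ (aux_iter_posDef A B hQ hR k (s + 1) X hX) (hPpos (s + 1))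
    rw [← hPrec] at h1
    have h2 := ih (s + 1) X hX
    rw [show s + 1 + k = s + (k + 1) by ring] at h2
    calc _ ≤ _ := h1
      _ ≤ ρ * (ρ ^ k * riemDelta X (P (s + (k + 1)))) := by gcongr
      _ = _ := by ring

end iter

open scoped MatrixOrder in
lemma aux_factor {n : ℕ} {Z : Matrix (Fin n) (Fin n) ℝ} (hZ : Z.PosDef) :
    ∃ C : Matrix (Fin n) (Fin n) ℝ, Z = Cᵀ * C := by
  obtain ⟨C, hC⟩ := CStarAlgebra.nonneg_iff_eq_star_mul_self.mp hZ.posSemidef.nonneg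
  exact ⟨C, by rw [hC, star_eq_conjTranspose, conjTranspose_eq_transpose_of_trivial]⟩

lemma aux_eig_le {n : ℕ} {S : Matrix (Fin n) (Fin n) ℝ} (hS : S.IsHermitian) {c : ℝ}
    (h : ∀ i, hS.eigenvalues i ≤ c) (x : Fin n → ℝ) : x ⬝ᵥ S *ᵥ x ≤ c * (x ⬝ᵥ x) := by
  have hp : (c • (1 : Matrix (Fin n) (Fin n) ℝ) - S).PosSemidef := by
    rw [posSemidef_iff_isHermitian_and_spectrum_nonneg]
    refine ⟨Matrix.IsHermitian.sub ?_ hS, ?_⟩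
    · simp [Matrix.IsHermitian, conjTranspose_eq_transpose_of_trivial]
    · intro a ha
      have h1 : c • (1 : Matrix (Fin n) (Fin n) ℝ) = algebraMap ℝ _ c :=
        (Algebra.algebraMap_eq_smul_one c).symm
      rw [h1, ← spectrum.singleton_sub_eq, hS.spectrum_real_eq_range_eigenvalues] at ha
      obtain ⟨_, rfl, _, ⟨i, rfl⟩, rfl⟩ := ha
      simpa using h i
  have := hp.dotProduct_mulVec_nonneg x
  simpa [sub_mulVec, smul_mulVec] using this

lemma aux_riem {n : ℕ} {Y Z : Matrix (Fin n) (Fin n) ℝ} (hY : Y.PosDef) (hZ : Z.PosDef)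
    {d : ℝ} (hd : riemDelta Y Z ≤ d) (x : Fin n → ℝ) :
    x ⬝ᵥ Y *ᵥ x ≤ Real.exp d * (x ⬝ᵥ Z *ᵥ x) := by
  obtain ⟨C, hC⟩ := aux_factor hZ
  have hCu : IsUnit C.det := by
    have := (isUnit_iff_isUnit_det Z).1 hZ.isUnit
    rw [hC, det_mul] at this
    exact isUnit_of_mul_isUnit_right this
  set D := C⁻¹ with hD
  have hS : (Dᵀ * Y * D).PosDef := by
    have := hY.conjTranspose_mul_mul_same (B := D)
      (mulVec_injective_iff_isUnit.2 (by rw [hD, isUnit_nonsing_inv_iff]; exact (isUnit_iff_isUnit_det C).2 hCu))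
    rwa [conjTranspose_eq_transpose_of_trivial] at this
  have hZi : Z⁻¹ = D * Dᵀ := by
    rw [hC, Matrix.mul_inv_rev, hD, transpose_nonsing_inv]
  have hch : (Y * Z⁻¹).charpoly = (Dᵀ * Y * D).charpoly := by
    rw [hZi, ← Matrix.mul_assoc, charpoly_mul_comm, ← Matrix.mul_assoc]
  have heig : ∀ i, hS.1.eigenvalues i ≤ Real.exp d := by
    intro i
    rw [← Real.log_le_iff_le_exp (hS.eigenvalues_pos i)]
    refine le_trans ?_ hd
    apply Real.le_sqrt_of_sq_le
    rw [hch, hS.1.roots_charpoly_eq_eigenvalues, Multiset.map_map]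
    change _ ≤ ∑ j, (Real.log (hS.1.eigenvalues j)) ^ 2
    exact Finset.single_le_sum (f := fun j => (Real.log (hS.1.eigenvalues j)) ^ 2)
      (fun j _ => sq_nonneg _) (Finset.mem_univ i)
  have := aux_eig_le hS.1 heig (C *ᵥ x)
  have hx : D *ᵥ (C *ᵥ x) = x := by
    rw [mulVec_mulVec, hD, nonsing_inv_mul _ hCu, one_mulVec]
  rw [← mulVec_mulVec, hx, ← mulVec_mulVec, aux_dot_tr, hx] at this
  rwa [hC, ← mulVec_mulVec, aux_dot_tr]

lemma aux_specNorm {n : ℕ} (M : Matrix (Fin n) (Fin n) ℝ) (x : Fin n → ℝ) :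
    x ⬝ᵥ M *ᵥ x ≤ specNorm M * (x ⬝ᵥ x) := by
  have h1 := inner_toEuclideanCLM M (WithLp.toLp 2 x) (WithLp.toLp 2 x)
  simp only at h1
  rw [← h1]
  have h2 : x ⬝ᵥ x = ‖WithLp.toLp 2 x‖ * ‖WithLp.toLp 2 x‖ := by
    rw [← real_inner_self_eq_norm_mul_norm, EuclideanSpace.inner_eq_star_dotProduct]
    simp
  rw [h2]
  refine (real_inner_le_norm _ _).trans ?_
  have h3 := (toEuclideanCLM (𝕜 := ℝ) M).le_opNorm (WithLp.toLp 2 x)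
  unfold specNorm
  nlinarith [norm_nonneg (WithLp.toLp 2 x)]

lemma aux_lamMin_le {n : ℕ} {M : Matrix (Fin n) (Fin n) ℝ} (hM : M.IsHermitian)
    (hpos : 0 < lamMin M) : lamMin M ≤ specNorm M := by
  rcases n with _ | n
  · exfalso
    have : spectrum ℝ M = ∅ := by
      rw [hM.spectrum_real_eq_range_eigenvalues]; exact Set.range_eq_empty _
    rw [lamMin, this, Real.sInf_empty] at hpos
    exact lt_irrefl _ hpos
  · have h1 : lamMin M ≤ hM.eigenvalues 0 :=
      csInf_le M.finite_spectrum.bddBelow (hM.eigenvalues_mem_spectrum_real 0)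
    refine h1.trans ?_
    set v : Fin (n + 1) → ℝ := (hM.eigenvectorBasis 0).ofLp with hv
    have hv1 : v ⬝ᵥ v = 1 := by
      have h : inner ℝ (hM.eigenvectorBasis 0) (hM.eigenvectorBasis 0) = (1 : ℝ) := by
        rw [real_inner_self_eq_norm_sq, hM.eigenvectorBasis.orthonormal.1]; norm_num
      rw [EuclideanSpace.inner_eq_star_dotProduct] at h
      simpa using h
    have h2 := aux_specNorm M v
    rw [hM.mulVec_eigenvectorBasis 0, dotProduct_smul] at h2
    rw [← hv, hv1] at h2
    simpa using h2

lemma aux_scalar {T : ℕ} (hT : 1 ≤ T) {ρ δ β D : ℝ} (hρ0 : 0 < ρ) (hρ1 : ρ < 1) (hδ : 0 < δ)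
    (hD : 0 < D) (hβ : 0 < β)
    (h : (1 : ℝ) + Real.log ((1 / δ) * Real.log (β / D + 1)) / Real.log ρ ≤ (T : ℝ)) :
    D * (Real.exp (ρ ^ (T - 1) * δ) - 1) ≤ β := by
  have hq : 0 < β / D := div_pos hβ hD
  have hl : 0 < Real.log (β / D + 1) := Real.log_pos (by linarith)
  have hc : 0 < (1 / δ) * Real.log (β / D + 1) := by positivity
  have hlr : Real.log ρ < 0 := Real.log_neg hρ0 hρ1
  have h1 : Real.log ((1 / δ) * Real.log (β / D + 1)) / Real.log ρ ≤ ((T - 1 : ℕ) : ℝ) := by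
    push_cast [hT]; linarith
  rw [div_le_iff_of_neg hlr, ← Real.log_pow, Real.log_le_log_iff (by positivity) hc] at h1
  have h2 : ρ ^ (T - 1) * δ ≤ Real.log (β / D + 1) := by
    calc _ ≤ (1 / δ) * Real.log (β / D + 1) * δ := by gcongr
      _ = _ := by field_simp
  rw [Real.le_log_iff_exp_le (by linarith)] at h2
  calc _ ≤ D * (β / D) := by gcongr; linarith
    _ = β := by field_simp

/-- horizon length achieving a performance-loss specification: if
`T ≥ 1 + log((1/δ̄)·log(β̄λ̲ω̲/(ω̄λ̄ω̄) + 1)) / log ρ` then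
`(λ̄/λ̲)(ω̄/ω̲)ω̄ (exp(ρ^{T−1} δ̄) − 1) ≤ β̄`, and consequently, under the hypotheses of
the `T`-step performance bound, the infinite-horizon performance loss is at most `β̄ |ξ|²`. -/
theorem horizon_for_performance_spec {n m : ℕ} (T : ℕ) (hT : 1 ≤ T)
    (A : ℕ → Matrix (Fin n) (Fin n) ℝ) (B : ℕ → Matrix (Fin n) (Fin m) ℝ)
    (Q : ℕ → Matrix (Fin n) (Fin n) ℝ) (R : ℕ → Matrix (Fin m) (Fin m) ℝ)
    (hQ : ∀ t, (Q t).PosDef) (hR : ∀ t, (R t).PosDef)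
    (ρ : ℝ) (hρ0 : 0 < ρ) (hρ1 : ρ < 1)
    (hcontr : ∀ t, ∀ Y Z : Matrix (Fin n) (Fin n) ℝ, Y.PosDef → Z.PosDef →
      riemDelta (ricc (A t) (B t) (Q t) (R t) Y) (ricc (A t) (B t) (Q t) (R t) Z)
        ≤ ρ * riemDelta Y Z)
    (P : ℕ → Matrix (Fin n) (Fin n) ℝ) (hPpos : ∀ t, (P t).PosDef)
    (hPrec : ∀ t, P t = ricc (A t) (B t) (Q t) (R t) (P (t + 1)))
    (X : ℕ → Matrix (Fin n) (Fin n) ℝ) (hXpos : ∀ s, (X s).PosDef)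
    (δbar : ℝ) (hδbar : 0 < δbar)
    (hXdec : ∀ s, (X s - ricc (A s) (B s) (Q s) (R s) (X (s + 1))).PosSemidef)
    (hXP : ∀ s, (X s - P s).PosSemidef)
    (hXPd : ∀ s, riemDelta (X s) (P s) ≤ δbar)
    (Xh : ℕ → Matrix (Fin n) (Fin n) ℝ)
    (hXh : ∀ s, Xh s = riccIter A B Q R s (T - 1) (X (s + (T - 1))))
    (K : ℕ → Matrix (Fin m) (Fin n) ℝ)
    (hK : ∀ t, K t = (R t + (B t)ᵀ * Xh (t + 1) * B t)⁻¹ * ((B t)ᵀ * Xh (t + 1) * A t))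
    (ξ : Fin n → ℝ) (x : ℕ → Fin n → ℝ) (u : ℕ → Fin m → ℝ)
    (hx0 : x 0 = ξ) (hu : ∀ t, u t = -(K t *ᵥ x t))
    (hx : ∀ t, x (t + 1) = A t *ᵥ x t + B t *ᵥ u t)
    (wbar wlow lamlow lambar : ℝ)
    (hwbar : 0 < wbar) (hwlow : 0 < wlow) (hlamlow : 0 < lamlow) (hlambar : 0 < lambar)
    (hlw : lamlow ≤ wbar)
    (hub : ∀ t, specNorm (ricc (A t) (B t) (Q t) (R t) (Xh (t + 1))) ≤ wbar)
    (hlb : ∀ t, wlow ≤ lamMin (ricc (A t) (B t) (Q t) (R t) (Xh (t + 1))))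
    (hgain : ∀ t, lamlow ≤ lamMin (Q t + (K t)ᵀ * R t * K t))
    (hPb : ∀ t, specNorm (P t) ≤ lambar)
    (βbar : ℝ) (hβbar : 0 < βbar)
    (hTspec : (1 : ℝ)
        + Real.log ((1 / δbar)
            * Real.log (βbar * lamlow * wlow / (wbar * lambar * wbar) + 1))
          / Real.log ρ ≤ (T : ℝ)) :
    (lambar / lamlow) * (wbar / wlow) * wbar
        * (Real.exp (ρ ^ (T - 1) * δbar) - 1) ≤ βbar ∧
    Summable (fun t => x t ⬝ᵥ Q t *ᵥ x t + u t ⬝ᵥ R t *ᵥ u t) ∧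
    (∑' t, (x t ⬝ᵥ Q t *ᵥ x t + u t ⬝ᵥ R t *ᵥ u t)) - ξ ⬝ᵥ P 0 *ᵥ ξ
      ≤ βbar * (ξ ⬝ᵥ ξ) := by
  have hDpos : 0 < wbar * lambar * wbar / (lamlow * wlow) := by positivity
  have hA : (lambar / lamlow) * (wbar / wlow) * wbar
        * (Real.exp (ρ ^ (T - 1) * δbar) - 1) ≤ βbar := by
    have := aux_scalar hT hρ0 hρ1 hδbar hDpos hβbar (by
      convert hTspec using 6
      field_simp)
    calc _ = wbar * lambar * wbar / (lamlow * wlow) * (Real.exp (ρ ^ (T - 1) * δbar) - 1) := by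
          field_simp
      _ ≤ _ := this
  refine ⟨hA, ?_⟩
  obtain ⟨k, rfl⟩ : ∃ k, T = k + 1 := ⟨T - 1, by omega⟩
  simp only [Nat.add_sub_cancel] at hXh hA
  have hXhp : ∀ s, (Xh s).PosDef := fun s => by
    rw [hXh]; exact aux_iter_posDef A B hQ hR _ _ _ (hXpos _)
  set W : ℕ → Matrix (Fin n) (Fin n) ℝ :=
    fun t => ricc (A t) (B t) (Q t) (R t) (Xh (t + 1)) with hW
  have hWp : ∀ t, (W t).PosDef := fun t => aux_ricc_posDef _ _ (hQ t) (hR t) (hXhp (t + 1))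
  have hWit : ∀ t, W t = riccIter A B Q R t (k + 1) (X (t + (k + 1))) := fun t => by
    change ricc _ _ _ _ _ = ricc _ _ _ _ _
    rw [hXh, show t + 1 + k = t + (k + 1) by ring]
  have hWle : ∀ t, (Xh t - W t).PosSemidef := fun t => by
    rw [hWit, aux_iter_last, hXh]
    exact aux_iter_mono A B hQ hR _ _ _ _ (aux_ricc_posDef _ _ (hQ _) (hR _) (hXpos _)) (hXpos _)
      (hXdec (t + k))
  have hstep : ∀ t, (x t ⬝ᵥ Q t *ᵥ x t + u t ⬝ᵥ R t *ᵥ u t) + x (t + 1) ⬝ᵥ W (t + 1) *ᵥ x (t + 1)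
      ≤ x t ⬝ᵥ W t *ᵥ x t := fun t => by
    have h1 := aux_ricc_eq (A t) (B t) (Q t) (hR t) (hXhp (t + 1)) (x t) (u t)
      (by rw [hu, hK])
    rw [← hx] at h1
    have h2 := (hWle (t + 1)).dotProduct_mulVec_nonneg (x (t + 1))
    rw [star_trivial, sub_mulVec, dotProduct_sub] at h2
    change _ ≤ x t ⬝ᵥ ricc (A t) (B t) (Q t) (R t) (Xh (t + 1)) *ᵥ x t
    linarith
  have hnn : ∀ t, 0 ≤ x t ⬝ᵥ Q t *ᵥ x t + u t ⬝ᵥ R t *ᵥ u t := fun t => by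
    have h1 := (hQ t).posSemidef.dotProduct_mulVec_nonneg (x t)
    have h2 := (hR t).posSemidef.dotProduct_mulVec_nonneg (u t)
    rw [star_trivial] at h1 h2
    linarith
  have hpart : ∀ N, ∑ t ∈ Finset.range N, (x t ⬝ᵥ Q t *ᵥ x t + u t ⬝ᵥ R t *ᵥ u t)
      + x N ⬝ᵥ W N *ᵥ x N ≤ ξ ⬝ᵥ W 0 *ᵥ ξ := fun N => by
    induction N with
    | zero => simp [hx0]
    | succ N ih => rw [Finset.sum_range_succ]; linarith [hstep N]
  have hpart' : ∀ N, ∑ t ∈ Finset.range N, (x t ⬝ᵥ Q t *ᵥ x t + u t ⬝ᵥ R t *ᵥ u t)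
      ≤ ξ ⬝ᵥ W 0 *ᵥ ξ := fun N => by
    have h1 := (hWp N).posSemidef.dotProduct_mulVec_nonneg (x N)
    rw [star_trivial] at h1
    linarith [hpart N]
  refine ⟨summable_of_sum_range_le hnn hpart', ?_⟩
  have hsum := Real.tsum_le_of_sum_range_le hnn hpart'
  have hδ : riemDelta (W 0) (P 0) ≤ ρ ^ k * δbar := by
    rw [hWit]
    have h1 := aux_iter_contr A B hQ hR hρ0 hcontr hPpos hPrec (k + 1) 0 _ (hXpos (0 + (k + 1)))
    calc _ ≤ _ := h1
      _ ≤ ρ ^ (k + 1) * δbar := by gcongr; exact hXPd _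
      _ ≤ ρ ^ k * δbar := by
        gcongr ?_ * _
        exact pow_le_pow_of_le_one hρ0.le hρ1.le (Nat.le_succ k)
  have hW0 := aux_riem (hWp 0) (hPpos 0) hδ ξ
  have hP0 : ξ ⬝ᵥ P 0 *ᵥ ξ ≤ lambar * (ξ ⬝ᵥ ξ) := by
    have hξ : 0 ≤ ξ ⬝ᵥ ξ := by simpa using dotProduct_star_self_nonneg ξ
    exact (aux_specNorm _ _).trans (mul_le_mul_of_nonneg_right (hPb 0) hξ)
  have hξ : 0 ≤ ξ ⬝ᵥ ξ := by simpa using dotProduct_star_self_nonneg ξ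
  have hww : wlow ≤ wbar :=
    (hlb 0).trans ((aux_lamMin_le (hWp 0).1 (hwlow.trans_le (hlb 0))).trans (hub 0))
  have hE : 0 ≤ Real.exp (ρ ^ k * δbar) - 1 := by
    have := Real.add_one_le_exp (ρ ^ k * δbar)
    have : 0 < ρ ^ k * δbar := by positivity
    linarith
  have hcoef : lambar ≤ (lambar / lamlow) * (wbar / wlow) * wbar := by
    have h1 : 1 ≤ wbar / lamlow := (one_le_div hlamlow).2 hlw
    have h2 : 1 ≤ wbar / wlow := (one_le_div hwlow).2 hww
    calc lambar = lambar * (1 * 1) := by ring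
      _ ≤ lambar * ((wbar / lamlow) * (wbar / wlow)) := by gcongr
      _ = _ := by ring
  calc _ ≤ Real.exp (ρ ^ k * δbar) * (ξ ⬝ᵥ P 0 *ᵥ ξ) - ξ ⬝ᵥ P 0 *ᵥ ξ := by linarith
    _ = (Real.exp (ρ ^ k * δbar) - 1) * (ξ ⬝ᵥ P 0 *ᵥ ξ) := by ring
    _ ≤ (Real.exp (ρ ^ k * δbar) - 1) * (lambar * (ξ ⬝ᵥ ξ)) := by gcongr
    _ = (lambar * (Real.exp (ρ ^ k * δbar) - 1)) * (ξ ⬝ᵥ ξ) := by ring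
    _ ≤ ((lambar / lamlow) * (wbar / wlow) * wbar * (Real.exp (ρ ^ k * δbar) - 1)) * (ξ ⬝ᵥ ξ) := by
        gcongr
    _ ≤ βbar * (ξ ⬝ᵥ ξ) := by gcongr
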